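/- arXiv:1307.0371 — 2 statements merged into one kernel-verified Lean document; each statement's English description precedes it below -/
import Mathlib

section
/- Let p be a prime and n ≥ 1 an integer, and let a = (a_1,…,a_n), b = (b_1,…,b_n) be tuples of nonnegative integers. Assume that either (i) a_1 = 1 and a_i ≤ b_i for all i ≥ 2, or (ii) not all a_i are 0 and a_i ≤ b_i for all i. Let μ be the measure on ℤ_p^n whose density with respect to λ^{⊠n} at x = (x_1,…,x_n) is ∏_{i=1}^n |x_i|_p^{b_i}. Then the push-forward of μ under the map x ↦ x_1^{a_1}⋯x_n^{a_n} : ℤ_p^n → ℤ_p has a continuous density with respect to λ; that is, there exists a continuous function f : ℤ_p → [0,∞) such that the push-forward measure equals the measure with density f with respect to λ. -/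
open MeasureTheory

section

variable {p : ℕ} [Fact p.Prime]

theorem PadicInt.exists_pow_eq_of_norm_sub_one_lt {a : ℕ} {v : ℤ_[p]}
    (hv : ‖v - 1‖ < ‖(a : ℤ_[p])‖ ^ 2) : ∃ u : ℤ_[p], ‖u‖ = 1 ∧ u ^ a = v := by
  have ha : a ≠ 0 := by
    rintro rfl
    simp at hv
    exact (norm_nonneg (v - 1)).not_gt hv
  have hv1 : ‖v‖ = 1 := by
    have h : ‖v - 1‖ < ‖(1 : ℤ_[p])‖ :=
      hv.trans_le (by simpa using PadicInt.norm_le_one (a : ℤ_[p]))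
    have h' := IsUltrametricDist.norm_add_eq_max_of_norm_ne_norm h.ne
    rwa [sub_add_cancel, max_eq_right h.le, norm_one] at h'
  obtain ⟨u, hu, -⟩ := hensels_lemma (p := p) (F := (Polynomial.X ^ a - Polynomial.C v))
    (a := (1 : ℤ_[p])) (by simpa [norm_sub_rev, Polynomial.derivative_X_pow] using hv)
  have hu' : u ^ a = v := by simpa [sub_eq_zero] using hu
  refine ⟨u, ?_, hu'⟩
  rw [← hu', norm_pow] at hv1
  exact (pow_eq_one_iff_of_nonneg (norm_nonneg u) ha).1 hv1

theorem PadicInt.norm_le_norm_iff_exists_mul {y : ℤ_[p]} (hy : y ≠ 0) {z : ℤ_[p]} :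
    ‖z‖ ≤ ‖y‖ ↔ ∃ s, s * y = z := by
  constructor
  · intro h
    have hy' : (y : ℚ_[p]) ≠ 0 := by simpa using hy
    refine ⟨⟨(z : ℚ_[p]) / y, ?_⟩, ?_⟩
    · rw [norm_div]
      exact div_le_one_of_le₀ h (norm_nonneg _)
    · exact Subtype.coe_injective (div_mul_cancel₀ (z : ℚ_[p]) hy')
  · rintro ⟨s, rfl⟩
    rw [norm_mul]
    exact mul_le_of_le_one_left (norm_nonneg _) (PadicInt.norm_le_one s)

theorem PadicInt.continuous_extend_zero {g : ℤ_[p] → ℝ} (hg : Continuous g) :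
    Continuous (Function.extend ((↑) : ℤ_[p] → ℚ_[p]) g 0) :=
  HasCompactSupport.continuous_extend_zero (U := {q : ℚ_[p] | ‖q‖ ≤ 1})
    (by simpa [Metric.closedBall] using
      IsUltrametricDist.isOpen_closedBall (0 : ℚ_[p]) one_ne_zero) hg
    (HasCompactSupport.of_compactSpace (α := ℤ_[p]) g)

variable [MeasurableSpace ℤ_[p]] [BorelSpace ℤ_[p]]
    (lam : Measure ℤ_[p]) [lam.IsAddHaarMeasure]

theorem PadicInt.haar_singleton (x : ℤ_[p]) : lam {x} = 0 := by
  have : (nhdsWithin (0 : ℤ_[p]) {0}ᶜ).NeBot := by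
    have h : Filter.Tendsto (fun k : ℕ => (p : ℤ_[p]) ^ k) Filter.atTop
        (nhdsWithin (0 : ℤ_[p]) {0}ᶜ) :=
      tendsto_nhdsWithin_iff.2 ⟨tendsto_pow_atTop_nhds_zero_of_norm_lt_one
        (by simp [PadicInt.norm_p, inv_lt_one_of_one_lt₀, (Fact.out : p.Prime).one_lt]),
        .of_forall fun k => pow_ne_zero k (by simpa using (Fact.out : p.Prime).ne_zero)⟩
    exact h.neBot
  have := Measure.IsAddHaarMeasure.nullSingletonClass lam
  exact measure_singleton x

variable [IsProbabilityMeasure lam]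

theorem PadicInt.haar_norm_le_norm {y : ℤ_[p]} (hy : y ≠ 0) :
    lam {z | ‖z‖ ≤ ‖y‖} = ENNReal.ofReal ‖y‖ := by
  set k := y.valuation
  have hk : ‖y‖ = (p : ℝ) ^ (-k : ℤ) := PadicInt.norm_eq_zpow_neg_valuation hy
  have hp : 0 < p := (Fact.out : p.Prime).pos
  let H : AddSubgroup ℤ_[p] := (PadicInt.toZModPow (p := p) k).toAddMonoidHom.ker
  have hH : (H : Set ℤ_[p]) = {z | ‖z‖ ≤ ‖y‖} := by
    ext z
    rw [Set.mem_ofPred_eq, hk, PadicInt.norm_le_pow_iff_mem_span_pow, ← PadicInt.ker_toZModPow]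
    rfl
  have hidx : H.index = p ^ k := by
    rw [AddSubgroup.index_ker]
    have : (PadicInt.toZModPow (p := p) k).toAddMonoidHom.range = ⊤ :=
      AddMonoidHom.range_eq_top.2 (ZMod.ringHom_surjective _)
    rw [this]
    simp
  have : H.FiniteIndex := ⟨by rw [hidx]; positivity⟩
  have hm : MeasurableSet (H : Set ℤ_[p]) := by
    rw [hH]; exact (isClosed_le continuous_norm continuous_const).measurableSet
  have hmul := AddSubgroup.index_mul_measure H hm lam
  rw [hH, hidx, measure_univ, mul_comm] at hmul
  rw [ENNReal.eq_inv_of_mul_eq_one_left hmul, hk, zpow_neg, zpow_natCast,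
    ENNReal.ofReal_inv_of_pos (by positivity), ← Nat.cast_pow, ENNReal.ofReal_natCast]

theorem PadicInt.lintegral_comp_mul_right {y : ℤ_[p]} (hy : y ≠ 0) (h : ℤ_[p] → ENNReal) :
    ∫⁻ s, h (s * y) ∂lam = ENNReal.ofReal ‖y‖⁻¹ * ∫⁻ z in {z | ‖z‖ ≤ ‖y‖}, h z ∂lam := by
  have hinj : Function.Injective fun s : ℤ_[p] => s * y := mul_left_injective₀ hy
  have he : MeasurableEmbedding fun s : ℤ_[p] => s * y :=
    (Continuous.isClosedEmbedding (by fun_prop) hinj).measurableEmbedding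
  have hr : Set.range (fun s : ℤ_[p] => s * y) = {z | ‖z‖ ≤ ‖y‖} :=
    Set.ext fun z => (PadicInt.norm_le_norm_iff_exists_mul hy).symm
  set τ := lam.comap fun s : ℤ_[p] => s * y with hτ
  have : IsFiniteMeasure τ := ⟨by rw [hτ, he.comap_apply]; exact measure_lt_top _ _⟩
  have : τ.IsAddLeftInvariant := by
    refine (forall_measure_preimage_add_iff τ).1 fun g A _ => ?_
    rw [hτ, he.comap_apply, he.comap_apply,
      ← measure_preimage_add lam (g * y) ((fun s => s * y) '' A)]
    congr 1
    ext z
    constructor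
    · rintro ⟨s, hs, rfl⟩
      exact ⟨g + s, hs, add_mul g s y⟩
    · rintro ⟨s, hs, hz : s * y = g * y + z⟩
      exact ⟨s - g, by simpa using hs, by simp [sub_mul, hz]⟩
  have hsm := Measure.isAddInvariant_eq_smul_of_compactSpace τ lam
  set c := τ.addHaarScalarFactor lam
  have hc : (c : ENNReal) = ENNReal.ofReal ‖y‖ := by
    have := congrArg (fun m : Measure ℤ_[p] => m Set.univ) hsm
    simp only [hτ, he.comap_apply, Set.image_univ, hr, Measure.smul_apply, measure_univ,
      PadicInt.haar_norm_le_norm lam hy] at this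
    simpa [ENNReal.smul_def] using this.symm
  have hint : ∫⁻ z in {z | ‖z‖ ≤ ‖y‖}, h z ∂lam = ENNReal.ofReal ‖y‖ * ∫⁻ s, h (s * y) ∂lam := by
    rw [← hr, ← he.map_comap, he.lintegral_map, ← hτ, hsm, lintegral_smul_measure,
      ENNReal.smul_def, hc, smul_eq_mul]
  have hy0 : 0 < ‖y‖ := norm_pos_iff.2 hy
  rw [hint, ← mul_assoc, ← ENNReal.ofReal_mul (by positivity), inv_mul_cancel₀ hy0.ne',
    ENNReal.ofReal_one, one_mul]

theorem PadicInt.measurePreserving_mul_right {u : ℤ_[p]} (hu : ‖u‖ = 1) :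
    MeasurePreserving (fun s => s * u) lam lam := by
  refine ⟨by fun_prop, Measure.ext fun A hA => ?_⟩
  have hu0 : u ≠ 0 := norm_ne_zero_iff.1 (by simp [hu])
  have := PadicInt.lintegral_comp_mul_right lam hu0 (A.indicator 1)
  simp only [hu, inv_one, ENNReal.ofReal_one, one_mul, PadicInt.norm_le_one,
    lintegral_indicator_one hA, Set.ofPred_true, Measure.restrict_univ] at this
  rw [Measure.map_apply (by fun_prop) hA, ← this,
    ← lintegral_indicator_one (hA.preimage (by fun_prop))]
  rfl

/-- The push-forward of `(g · λ) ⊗ (w · m)` under `(s, x) ↦ s * y x` has a continuous density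
whenever `g` is continuous and `w ≤ ‖y‖`. -/
theorem PadicInt.exists_density_mul {X : Type*} [MeasurableSpace X] (m : Measure X)
    [IsFiniteMeasure m] {g : ℤ_[p] → ℝ} (hg : Continuous g) (hg0 : ∀ s, 0 ≤ g s)
    {y : X → ℤ_[p]} (hy : Measurable y) (hy0 : ∀ᵐ x ∂m, y x ≠ 0)
    {w : X → ℝ} (hw : Measurable w) (hw0 : ∀ x, 0 ≤ w x) (hwy : ∀ x, w x ≤ ‖y x‖) :
    ∃ f : ℤ_[p] → ℝ, Continuous f ∧ (∀ z, 0 ≤ f z) ∧ ∀ A, MeasurableSet A →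
      ∫⁻ x, ENNReal.ofReal (w x) *
        (∫⁻ s, A.indicator 1 (s * y x) * ENNReal.ofReal (g s) ∂lam) ∂m =
      ∫⁻ z in A, ENNReal.ofReal (f z) ∂lam := by
  borelize ℚ_[p]
  set G : ℚ_[p] → ℝ := Function.extend ((↑) : ℤ_[p] → ℚ_[p]) g 0
  have hG : Continuous G := PadicInt.continuous_extend_zero hg
  have hGcoe (s : ℤ_[p]) : G s = g s := Subtype.val_injective.extend_apply g 0 s
  have hGout (q : ℚ_[p]) (hq : ¬ ‖q‖ ≤ 1) : G q = 0 :=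
    Function.extend_apply' _ _ _ (by rintro ⟨s, rfl⟩; exact hq s.2)
  have hG0 (q : ℚ_[p]) : 0 ≤ G q := by
    by_cases hq : ‖q‖ ≤ 1
    · exact (hGcoe ⟨q, hq⟩).symm ▸ hg0 _
    · exact (hGout q hq).ge
  obtain ⟨C, hC⟩ : ∃ C, ∀ q, G q ≤ C := by
    obtain ⟨C, hC⟩ := (isCompact_range hg).bddAbove
    have hC' (s) : g s ≤ C := hC ⟨s, rfl⟩
    refine ⟨C, fun q => ?_⟩
    by_cases hq : ‖q‖ ≤ 1
    · exact (hGcoe ⟨q, hq⟩).symm ▸ hC' _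
    · exact (hGout q hq).trans_le ((hg0 0).trans (hC' 0))
  let F : ℤ_[p] → X → ℝ := fun z x => w x * ‖y x‖⁻¹ * G ((z : ℚ_[p]) / (y x : ℚ_[p]))
  have hcoe : Continuous fun z : ℤ_[p] => (z : ℚ_[p]) := PadicInt.isOpenEmbedding_coe.continuous
  have hcoe_meas : Measurable fun z : ℤ_[p] => (z : ℚ_[p]) := hcoe.measurable
  have hF : Measurable (Function.uncurry F) := by
    have h1 : Measurable fun q : ℤ_[p] × X => G ((q.1 : ℚ_[p]) / (y q.2 : ℚ_[p])) :=
      hG.measurable.comp ((hcoe_meas.comp measurable_fst).div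
        (hcoe_meas.comp (hy.comp measurable_snd)))
    exact ((hw.comp measurable_snd).mul (hy.comp measurable_snd).norm.inv).mul h1
  have hF0 (z x) : 0 ≤ F z x := mul_nonneg (mul_nonneg (hw0 x) (by positivity)) (hG0 _)
  have hFC (z x) : ‖F z x‖ ≤ C := by
    rw [Real.norm_of_nonneg (hF0 z x)]
    have h1 : w x * ‖y x‖⁻¹ ≤ 1 := by
      rw [← div_eq_mul_inv]
      exact div_le_one_of_le₀ (hwy x) (norm_nonneg _)
    exact (mul_le_of_le_one_left (hG0 _) h1).trans (hC _)
  have hFm (z) : Measurable (F z) := hF.comp measurable_prodMk_left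
  refine ⟨fun z => ∫ x, F z x ∂m, ?_, fun z => integral_nonneg (hF0 z), fun A hA => ?_⟩
  · refine continuous_of_dominated (bound := fun _ => C) (fun z => (hFm z).aestronglyMeasurable)
      (fun z => .of_forall (hFC z)) (integrable_const C) (.of_forall fun x => ?_)
    exact continuous_const.mul (hG.comp (hcoe.div_const _))
  · have hof (z) : ENNReal.ofReal (∫ x, F z x ∂m) = ∫⁻ x, ENNReal.ofReal (F z x) ∂m :=
      ofReal_integral_eq_lintegral_ofReal
        (.of_bound (hFm z).aestronglyMeasurable C (.of_forall (hFC z))) (.of_forall (hF0 z))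
    simp only [hof]
    rw [lintegral_lintegral_swap hF.ennreal_ofReal.aemeasurable]
    refine lintegral_congr_ae (hy0.mono fun x hx => ?_)
    have hx' : (y x : ℚ_[p]) ≠ 0 := by simpa using hx
    have hB : MeasurableSet {z : ℤ_[p] | ‖z‖ ≤ ‖y x‖} :=
      (isClosed_le continuous_norm continuous_const).measurableSet
    have hsub := PadicInt.lintegral_comp_mul_right lam hx fun z : ℤ_[p] =>
        A.indicator 1 z * ENNReal.ofReal (G ((z : ℚ_[p]) / (y x : ℚ_[p])))
    simp only [PadicInt.coe_mul, mul_div_cancel_right₀ _ hx', hGcoe] at hsub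
    simp only [hsub]
    rw [← lintegral_indicator hB, ← lintegral_indicator hA, ← mul_assoc,
      ← ENNReal.ofReal_mul (hw0 x), ← lintegral_const_mul' _ _ ENNReal.ofReal_ne_top]
    refine lintegral_congr fun z => ?_
    by_cases hzA : z ∈ A
    · by_cases hz : ‖z‖ ≤ ‖y x‖
      · simp [hzA, hz, F, ENNReal.ofReal_mul, hw0, mul_nonneg]
      · have : G ((z : ℚ_[p]) / (y x : ℚ_[p])) = 0 := by
          refine hGout _ fun h => hz ?_
          rw [norm_div] at h
          exact (div_le_one (norm_pos_iff.2 hx')).1 h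
        simp [hzA, hz, F, this]
    · simp [hzA, Set.indicator]

end

theorem PadicInt.measurable_prod_pow {p : ℕ} [Fact p.Prime] {ι : Type*} [Fintype ι]
    [MeasurableSpace ℤ_[p]] [BorelSpace ℤ_[p]] (a : ι → ℕ) :
    Measurable fun x : ι → ℤ_[p] => ∏ i, x i ^ a i :=
  Finset.measurable_prod _ fun i _ => (measurable_pi_apply i).pow_const _

theorem PadicInt.measurable_prod_norm_pow {p : ℕ} [Fact p.Prime] {ι : Type*} [Fintype ι]
    [MeasurableSpace ℤ_[p]] [BorelSpace ℤ_[p]] (b : ι → ℕ) :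
    Measurable fun x : ι → ℤ_[p] => ∏ i, ‖x i‖ ^ b i :=
  Finset.measurable_prod _ fun i _ => (measurable_pi_apply i).norm.pow_const _

theorem PadicInt.prod_norm_pow_le {p : ℕ} [Fact p.Prime] {ι : Type*} [Fintype ι]
    {a b : ι → ℕ} (hab : ∀ i, a i ≤ b i) (x : ι → ℤ_[p]) :
    ∏ i, ‖x i‖ ^ b i ≤ ‖∏ i, x i ^ a i‖ := by
  rw [norm_prod]
  refine Finset.prod_le_prod (fun i _ => by positivity) fun i _ => ?_
  rw [norm_pow]
  exact pow_le_pow_of_le_one (norm_nonneg _) (PadicInt.norm_le_one _) (hab i)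

section

variable {p : ℕ} [Fact p.Prime] [MeasurableSpace ℤ_[p]] [BorelSpace ℤ_[p]]
    (lam : Measure ℤ_[p]) [lam.IsAddHaarMeasure] [IsProbabilityMeasure lam]
    {ι : Type*} [Fintype ι]

omit [IsProbabilityMeasure lam] in
theorem PadicInt.ae_prod_pow_ne_zero (a : ι → ℕ) :
    ∀ᵐ x ∂Measure.pi fun _ : ι => lam, ∏ i, x i ^ a i ≠ 0 := by
  have : NullSingletonClass lam := ⟨PadicInt.haar_singleton lam⟩
  have h (i : ι) := Measure.ae_eval_ne (μ := fun _ : ι => lam) i (0 : ℤ_[p])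
  filter_upwards [ae_all_iff.2 h] with x hx
  exact Finset.prod_ne_zero_iff.2 fun i _ => pow_ne_zero _ (hx i)

/-- Multiplying one coordinate by a unit `u` leaves the monomial measure invariant. -/
theorem PadicInt.lintegral_indicator_pow_mul_prod_pow (a b : ι → ℕ) (i : ι) {u : ℤ_[p]}
    (hu : ‖u‖ = 1) {A : Set ℤ_[p]} (hA : MeasurableSet A) :
    ∫⁻ x, ENNReal.ofReal (∏ j, ‖x j‖ ^ b j) * A.indicator 1 (u ^ a i * ∏ j, x j ^ a j)
        ∂Measure.pi (fun _ : ι => lam) =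
      ∫⁻ x, ENNReal.ofReal (∏ j, ‖x j‖ ^ b j) * A.indicator 1 (∏ j, x j ^ a j)
        ∂Measure.pi (fun _ : ι => lam) := by
  classical
  have hpres := measurePreserving_pi (fun _ : ι => lam) (fun _ : ι => lam)
    (f := fun j s => s * if j = i then u else 1) fun j =>
      PadicInt.measurePreserving_mul_right lam (by split_ifs <;> simp [hu])
  have hmeas : Measurable fun x : ι → ℤ_[p] =>
      ENNReal.ofReal (∏ j, ‖x j‖ ^ b j) * A.indicator (1 : ℤ_[p] → ENNReal) (∏ j, x j ^ a j) :=
    (PadicInt.measurable_prod_norm_pow b).ennreal_ofReal.mul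
      ((measurable_one.indicator hA).comp (PadicInt.measurable_prod_pow a))
  rw [← hpres.lintegral_comp hmeas]
  refine lintegral_congr fun x => ?_
  have h1 : ∏ j, ‖x j * if j = i then u else 1‖ ^ b j = ∏ j, ‖x j‖ ^ b j :=
    Finset.prod_congr rfl fun j _ => by split_ifs <;> simp [hu]
  have h2 : ∏ j, (x j * if j = i then u else 1) ^ a j = u ^ a i * ∏ j, x j ^ a j := by
    simp only [mul_pow, Finset.prod_mul_distrib, ite_pow, one_pow, Finset.prod_ite_eq',
      Finset.mem_univ, if_true, mul_comm]
  rw [h1, h2]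

/-- The case where every exponent is dominated. -/
theorem PadicInt.exists_density_prod_pow {a b : ι → ℕ} {i : ι} (hi : a i ≠ 0)
    (hab : ∀ j, a j ≤ b j) :
    ∃ f : ℤ_[p] → ℝ, Continuous f ∧ (∀ z, 0 ≤ f z) ∧ ∀ A, MeasurableSet A →
      ∫⁻ x, ENNReal.ofReal (∏ j, ‖x j‖ ^ b j) * A.indicator 1 (∏ j, x j ^ a j)
        ∂Measure.pi (fun _ : ι => lam) =
      ∫⁻ z in A, ENNReal.ofReal (f z) ∂lam := by
  set r := ‖(a i : ℤ_[p])‖ ^ 2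
  have hr : 0 < r := pow_pos (norm_pos_iff.2 (by exact_mod_cast hi)) 2
  set V := Metric.ball (1 : ℤ_[p]) r
  have hV : IsClopen V := IsUltrametricDist.isClopen_ball 1 r
  have hVm : MeasurableSet V := hV.isOpen.measurableSet
  have hV0 : lam V ≠ 0 := (Metric.measure_ball_pos lam 1 hr).ne'
  have hVr : 0 < lam.real V := ENNReal.toReal_pos hV0 (measure_ne_top _ _)
  set g : ℤ_[p] → ℝ := V.indicator fun _ => (lam.real V)⁻¹
  have hg : Continuous g := hV.continuous_indicator continuous_const
  have hg0 (s) : 0 ≤ g s := Set.indicator_nonneg (fun _ _ => by positivity) s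
  have hg1 : ∫⁻ s, ENNReal.ofReal (g s) ∂lam = 1 := by
    have : (fun s => ENNReal.ofReal (g s)) = V.indicator fun _ => (lam V)⁻¹ := by
      ext s
      by_cases hs : s ∈ V
      · simp [g, hs, ENNReal.ofReal_inv_of_pos hVr]
      · simp [g, hs]
    rw [this, lintegral_indicator_const hVm, ENNReal.inv_mul_cancel hV0 (measure_ne_top _ _)]
  obtain ⟨f, hf, hf0, hfA⟩ := PadicInt.exists_density_mul lam (Measure.pi fun _ : ι => lam) hg hg0
    (PadicInt.measurable_prod_pow a) (PadicInt.ae_prod_pow_ne_zero lam a)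
    (PadicInt.measurable_prod_norm_pow b) (fun x => by positivity) (PadicInt.prod_norm_pow_le hab)
  refine ⟨f, hf, hf0, fun A hA => ?_⟩
  rw [← hfA A hA]
  set I := ∫⁻ x, ENNReal.ofReal (∏ j, ‖x j‖ ^ b j) * A.indicator 1 (∏ j, x j ^ a j)
    ∂Measure.pi (fun _ : ι => lam)
  have hW := (PadicInt.measurable_prod_norm_pow (p := p) b).ennreal_ofReal
  have hP := PadicInt.measurable_prod_pow (p := p) a
  calc I = ∫⁻ s, ENNReal.ofReal (g s) * I ∂lam := by
        rw [lintegral_mul_const _ hg.measurable.ennreal_ofReal, hg1, one_mul]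
    _ = ∫⁻ s, ∫⁻ x, ENNReal.ofReal (∏ j, ‖x j‖ ^ b j) *
          (A.indicator 1 (s * ∏ j, x j ^ a j) * ENNReal.ofReal (g s))
          ∂Measure.pi (fun _ : ι => lam) ∂lam := by
        refine lintegral_congr fun s => ?_
        simp only [← mul_assoc]
        rw [lintegral_mul_const' _ _ ENNReal.ofReal_ne_top, mul_comm]
        by_cases hs : s ∈ V
        · obtain ⟨u, hu, rfl⟩ := PadicInt.exists_pow_eq_of_norm_sub_one_lt
            (by simpa [V, dist_eq_norm] using hs)
          rw [PadicInt.lintegral_indicator_pow_mul_prod_pow lam a b i hu hA]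
        · simp [g, hs]
    _ = _ := by
        rw [lintegral_lintegral_swap]
        · refine lintegral_congr fun x => ?_
          exact lintegral_const_mul' _ _ ENNReal.ofReal_ne_top
        · exact ((hW.comp measurable_snd).mul (((measurable_one.indicator hA).comp
            (measurable_fst.mul (hP.comp measurable_snd))).mul
            (hg.measurable.ennreal_ofReal.comp measurable_fst))).aemeasurable

/-- The case where the first variable occurs to the first power. -/
theorem PadicInt.exists_density_mul_prod_pow (b₀ : ℕ) {a b : ι → ℕ} (hab : ∀ j, a j ≤ b j) :
    ∃ f : ℤ_[p] → ℝ, Continuous f ∧ (∀ z, 0 ≤ f z) ∧ ∀ A, MeasurableSet A →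
      ∫⁻ q, ENNReal.ofReal (‖q.1‖ ^ b₀ * ∏ j, ‖q.2 j‖ ^ b j) *
          A.indicator 1 (q.1 * ∏ j, q.2 j ^ a j)
        ∂lam.prod (Measure.pi fun _ : ι => lam) =
      ∫⁻ z in A, ENNReal.ofReal (f z) ∂lam := by
  have hg : Continuous fun s : ℤ_[p] => ‖s‖ ^ b₀ := by fun_prop
  obtain ⟨f, hf, hf0, hfA⟩ := PadicInt.exists_density_mul lam (Measure.pi fun _ : ι => lam) hg
    (fun s => by positivity)
    (PadicInt.measurable_prod_pow a) (PadicInt.ae_prod_pow_ne_zero lam a)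
    (PadicInt.measurable_prod_norm_pow b) (fun x => by positivity) (PadicInt.prod_norm_pow_le hab)
  refine ⟨f, hf, hf0, fun A hA => ?_⟩
  have hW := PadicInt.measurable_prod_norm_pow (p := p) b
  have hP := PadicInt.measurable_prod_pow (p := p) a
  rw [← hfA A hA, lintegral_prod_symm]
  · refine lintegral_congr fun x => ?_
    rw [← lintegral_const_mul' _ _ ENNReal.ofReal_ne_top]
    refine lintegral_congr fun s => ?_
    rw [ENNReal.ofReal_mul (by positivity)]
    ring
  · exact (((hg.measurable.comp measurable_fst).mul (hW.comp measurable_snd)).ennreal_ofReal.mul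
      ((measurable_one.indicator hA).comp
        (measurable_fst.mul (hP.comp measurable_snd)))).aemeasurable

end

/-- Push-forward of monomial measures under monomial maps on `ℤ_p^n`: if either
(i) `a 0 = 1` and `a i ≤ b i` for `i ≠ 0`, or (ii) some `a i ≠ 0` and `a i ≤ b i` for
all `i`, then the push-forward of the measure with density `∏ |x_i|_p^{b_i}` (with
respect to the product Haar probability measure on `ℤ_p^n`) under
`x ↦ x_1^{a_1}⋯x_n^{a_n}` has a continuous density with respect to the Haar probability
measure `λ` on `ℤ_p`. -/
theorem monomial_pushforward_continuous_density (p : ℕ) [Fact p.Prime]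
    (n : ℕ) (hn : 0 < n) (a b : Fin n → ℕ)
    [MeasurableSpace ℤ_[p]] [BorelSpace ℤ_[p]]
    (lam : Measure ℤ_[p]) [lam.IsAddHaarMeasure] [IsProbabilityMeasure lam]
    (hab : (a ⟨0, hn⟩ = 1 ∧ ∀ i : Fin n, i ≠ ⟨0, hn⟩ → a i ≤ b i) ∨
      ((∃ i, a i ≠ 0) ∧ ∀ i, a i ≤ b i)) :
    ∃ f : ℤ_[p] → ℝ, Continuous f ∧ (∀ y, 0 ≤ f y) ∧
      Measure.map (fun x : Fin n → ℤ_[p] => ∏ i, x i ^ a i)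
        ((Measure.pi fun _ : Fin n => lam).withDensity
          fun x => ∏ i, ENNReal.ofReal (‖x i‖ ^ b i)) =
      lam.withDensity fun y => ENNReal.ofReal (f y) := by
  obtain ⟨f, hf, hf0, hfA⟩ : ∃ f : ℤ_[p] → ℝ, Continuous f ∧ (∀ z, 0 ≤ f z) ∧
      ∀ A, MeasurableSet A →
        ∫⁻ x, ENNReal.ofReal (∏ j, ‖x j‖ ^ b j) * A.indicator 1 (∏ j, x j ^ a j)
          ∂Measure.pi (fun _ : Fin n => lam) =
        ∫⁻ z in A, ENNReal.ofReal (f z) ∂lam := by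
    rcases hab with ⟨h0, hab⟩ | ⟨⟨i, hi⟩, hab⟩
    · obtain ⟨m, rfl⟩ := Nat.exists_eq_succ_of_ne_zero hn.ne'
      have h0' : a 0 = 1 := h0
      obtain ⟨f, hf, hf0, hfA⟩ := PadicInt.exists_density_mul_prod_pow lam (b 0)
        (a := fun j : Fin m => a j.succ) (b := fun j => b j.succ)
        fun j => hab j.succ (Fin.succ_ne_zero j)
      refine ⟨f, hf, hf0, fun A hA => ?_⟩
      rw [← hfA A hA, ← (measurePreserving_piFinSuccAbove (fun _ => lam) 0).lintegral_comp_emb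
        (MeasurableEquiv.measurableEmbedding _)]
      refine lintegral_congr fun x => ?_
      simp [Fin.prod_univ_succ, h0', Fin.tail]
    · exact PadicInt.exists_density_prod_pow lam hi hab
  refine ⟨f, hf, hf0, Measure.ext fun A hA => ?_⟩
  have hP := PadicInt.measurable_prod_pow (p := p) a
  rw [Measure.map_apply hP hA, withDensity_apply _ (hP hA), withDensity_apply _ hA, ← hfA A hA,
    ← lintegral_indicator (hP hA)]
  refine lintegral_congr fun x => ?_
  rw [ENNReal.ofReal_prod_of_nonneg fun i _ => by positivity]
  by_cases hx : ∏ i, x i ^ a i ∈ A <;> simp [Set.indicator, hx]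
end

section
/- Fix a real number q > 1 and an integer n ≥ 1. Let R : ℤ_{≥0}^n → ℂ be a V-function, i.e. R(x) = Σ_{i=1}^N α_i f_i(x) q^{φ_i(x)} with α_i ∈ ℂ, f_i ∈ ℚ[x_1,…,x_n] polynomials and φ_i : ℚ^n → ℚ linear functionals. Suppose there are no p, v ∈ ℤ_{≥0}^n such that |R(p + m·v)| → ∞ as m → ∞. Then R extends to a continuous function on (ℤ_{≥0} ∪ {∞})^n, where ℤ_{≥0} ∪ {∞} carries the topology of the one-point compactification of the discrete space ℤ_{≥0}. -/
/-- The V-function `x ↦ Σ_i α_i · f_i(x) · q^{φ_i(x)}` on `ℤ_{≥0}^n`. -/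
noncomputable def Vfun (q : ℝ) {n N : ℕ} (α : Fin N → ℂ)
    (f : Fin N → MvPolynomial (Fin n) ℚ) (φ : Fin N → ((Fin n → ℚ) →ₗ[ℚ] ℚ))
    (x : Fin n → ℕ) : ℂ :=
  ∑ i : Fin N, α i * ((MvPolynomial.eval (fun j => (x j : ℚ)) (f i) : ℚ) : ℂ) *
    ((q ^ (((φ i) (fun j => (x j : ℚ)) : ℚ) : ℝ) : ℝ) : ℂ)

open Filter Asymptotics

/-- The function `m ↦ m ^ k * exp (c * m)`, indexed by `(c, k)` in lexicographic order, which is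
the order of growth. -/
noncomputable def expMonomial (s : ℝ ×ₗ ℕ) (m : ℕ) : ℂ :=
  (m : ℂ) ^ (ofLex s).2 * (Real.exp (ofLex s).1 : ℂ) ^ m

lemma expMonomial_zero : expMonomial 0 = fun _ => 1 := by
  funext m
  simp [expMonomial]

lemma expMonomial_isLittleO {s t : ℝ ×ₗ ℕ} (h : s < t) :
    expMonomial s =o[atTop] expMonomial t := by
  rcases Prod.Lex.lt_iff.1 h with h | ⟨h₁, h₂⟩
  · have hlt : ‖(Real.exp (ofLex s).1 : ℂ)‖ < Real.exp (ofLex t).1 := by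
      rw [Complex.norm_real, Real.norm_eq_abs, Real.abs_exp]
      exact Real.exp_lt_exp.2 h
    refine (isLittleO_pow_const_mul_const_pow_const_pow_of_norm_lt (R := ℂ) (ofLex s).2
      hlt).trans_isBigO (IsBigO.of_bound 1 ?_)
    filter_upwards [eventually_ge_atTop 1] with m hm
    have hm' : (1 : ℝ) ≤ (m : ℝ) ^ (ofLex t).2 := one_le_pow₀ (by exact_mod_cast hm)
    simp only [expMonomial, norm_mul, norm_pow, Complex.norm_natCast, Complex.norm_real, one_mul]
    exact le_mul_of_one_le_left (by positivity) hm'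
  · have hpow : (fun m : ℕ => (m : ℂ) ^ (ofLex s).2) =o[atTop]
        fun m : ℕ => (m : ℂ) ^ (ofLex t).2 := by
      have := (isLittleO_pow_pow_atTop_of_lt (𝕜 := ℝ) h₂).comp_tendsto
        tendsto_natCast_atTop_atTop
      rw [← isLittleO_norm_norm]
      rw [← isLittleO_norm_norm] at this
      simpa [Function.comp_def] using this
    unfold expMonomial
    simpa only [h₁] using hpow.mul_isBigO
      (isBigO_refl (fun m : ℕ => (Real.exp (ofLex t).1 : ℂ) ^ m) atTop)

/-- If a combination of functions of pairwise comparable growth does not diverge, then the part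
consisting of the divergent functions vanishes. -/
lemma sum_divergent_eq_zero {ι K : Type*} [LinearOrder K] {u : K → ℕ → ℂ} {s₀ : K}
    (hu : ∀ s t, s < t → u s =o[atTop] u t) (hs₀ : u s₀ = fun _ => 1)
    (S : Finset ι) (a : ι → ℂ) (s : ι → K)
    (h : ¬ Tendsto (fun m => ‖∑ i ∈ S, a i * u (s i) m‖) atTop atTop) (m : ℕ) :
    ∑ i ∈ S with s₀ < s i, a i * u (s i) m = 0 := by
  classical
  set A : K → ℂ := fun t => ∑ i ∈ S with s i = t, a i with hA
  have hgroup (m : ℕ) (t : K) : ∑ i ∈ S with s i = t, a i * u (s i) m = A t * u t m := by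
    rw [hA, Finset.sum_mul]
    refine Finset.sum_congr rfl fun i hi => ?_
    rw [(Finset.mem_filter.1 hi).2]
  have hsum (m : ℕ) : ∑ i ∈ S, a i * u (s i) m = ∑ t ∈ S.image s, A t * u t m := by
    rw [← Finset.sum_fiberwise_of_maps_to (fun i hi => Finset.mem_image_of_mem s hi)]
    exact Finset.sum_congr rfl fun t _ => hgroup m t
  by_cases hT : ((S.image s).filter fun t => s₀ < t ∧ A t ≠ 0).Nonempty
  · obtain ⟨t, ht, hmax⟩ := Finset.exists_max_image _ id hT
    simp only [Finset.mem_filter, id] at ht hmax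
    obtain ⟨htS, hst, hAt⟩ := ht
    refine absurd ?_ h
    have hrest : (fun m => ∑ r ∈ (S.image s).erase t, A r * u r m) =o[atTop]
        fun m => A t * u t m := by
      refine IsLittleO.fun_sum fun r hr => ?_
      obtain ⟨hrt, hrS⟩ := Finset.mem_erase.1 hr
      rcases lt_or_gt_of_ne hrt with hlt | hgt
      · exact ((hu r t hlt).const_mul_left _).const_mul_right hAt
      · have : A r = 0 := by
          by_contra hAr
          exact absurd (hmax r ⟨hrS, hst.trans hgt, hAr⟩) (not_le.2 hgt)
        simp [this]
    have hequiv : (fun m => ∑ i ∈ S, a i * u (s i) m) ~[atTop] fun m => A t * u t m := by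
      refine hrest.congr_left fun m => ?_
      simp only [Pi.sub_apply]
      rw [hsum, ← Finset.add_sum_erase _ _ htS, add_sub_cancel_left]
    have hone : (fun _ : ℕ => (1 : ℂ)) =o[atTop] fun m => A t * u t m := by
      rw [← hs₀]
      exact (hu s₀ t hst).const_mul_right hAt
    exact (isLittleO_one_left_iff ℂ).1 (hone.trans_isBigO hequiv.isBigO_symm)
  · rw [← Finset.sum_fiberwise_of_maps_to (t := (S.image s).filter (s₀ < ·)) (g := s)]
    · refine Finset.sum_eq_zero fun t ht => ?_
      obtain ⟨htS, hst⟩ := Finset.mem_filter.1 ht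
      have hAt : A t = 0 := by
        by_contra hAt
        exact hT ⟨t, Finset.mem_filter.2 ⟨htS, hst, hAt⟩⟩
      have : {i ∈ {i ∈ S | s₀ < s i} | s i = t} = {i ∈ S | s i = t} := by
        ext i
        simp only [Finset.mem_filter]
        constructor
        · rintro ⟨⟨h₁, -⟩, h₂⟩
          exact ⟨h₁, h₂⟩
        · rintro ⟨h₁, h₂⟩
          exact ⟨⟨h₁, h₂ ▸ hst⟩, h₂⟩
      rw [this, hgroup, hAt, zero_mul]
    · intro i hi
      obtain ⟨h₁, h₂⟩ := Finset.mem_filter.1 hi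
      exact Finset.mem_filter.2 ⟨Finset.mem_image_of_mem s h₁, h₂⟩

/-- A combination of products of `expMonomial`s that diverges along no ray equals the
subcombination of those products all of whose factors are bounded. -/
lemma sum_eq_sum_bounded {ι : Type*} {n : ℕ} (S : Finset ι) (a : ι → ℂ)
    (s : ι → Fin n → ℝ ×ₗ ℕ) (F : (Fin n → ℕ) → ℂ)
    (hF : ∀ x, F x = ∑ i ∈ S, a i * ∏ j, expMonomial (s i j) (x j))
    (h : ∀ P v : Fin n → ℕ, ¬ Tendsto (fun m : ℕ => ‖F (fun j => P j + m * v j)‖) atTop atTop)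
    (x : Fin n → ℕ) :
    F x = ∑ i ∈ S with ∀ j, s i j ≤ 0, a i * ∏ j, expMonomial (s i j) (x j) := by
  classical
  have key (J : Finset (Fin n)) : ∀ x, F x =
      ∑ i ∈ S with ∀ j ∈ J, s i j ≤ 0, a i * ∏ j, expMonomial (s i j) (x j) := by
    induction J using Finset.induction_on with
    | empty => simpa using hF
    | insert j J _ ih =>
      intro x
      have hray (m : ℕ) : (fun l => Function.update x j 0 l + m * Pi.single (M := fun _ => ℕ) j 1 l)
          = Function.update x j m := by
        funext l
        rcases eq_or_ne l j with rfl | hl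
        · simp
        · simp [hl]
      have hprod (i : ι) (m : ℕ) : a i * ∏ l, expMonomial (s i l) (Function.update x j m l) =
          (a i * ∏ l ∈ Finset.univ.erase j, expMonomial (s i l) (x l)) *
            expMonomial (s i j) m := by
        rw [← Finset.mul_prod_erase _ _ (Finset.mem_univ j), Function.update_self]
        have : ∏ l ∈ Finset.univ.erase j, expMonomial (s i l) (Function.update x j m l) =
            ∏ l ∈ Finset.univ.erase j, expMonomial (s i l) (x l) :=
          Finset.prod_congr rfl fun l hl => by
            rw [Function.update_of_ne (Finset.ne_of_mem_erase hl)]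
        rw [this]
        ring
      have hj := h (Function.update x j 0) (Pi.single j 1)
      simp only [hray, ih, hprod] at hj
      have hzero := sum_divergent_eq_zero (fun _ _ => expMonomial_isLittleO) expMonomial_zero
        _ _ _ hj (x j)
      simp only [← hprod, Function.update_eq_self] at hzero
      rw [ih x, ← Finset.sum_filter_add_sum_filter_not _ (fun i => 0 < s i j), hzero, zero_add,
        Finset.filter_filter]
      refine Finset.sum_congr (Finset.filter_congr fun i _ => ?_) fun _ _ => rfl
      simp only [Finset.forall_mem_insert, not_lt]
      exact and_comm
  simpa using key Finset.univ x

lemma exists_continuous_extension_expMonomial {s : ℝ ×ₗ ℕ} (hs : s ≤ 0) :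
    ∃ g : OnePoint ℕ → ℂ, Continuous g ∧ ∀ m : ℕ, g m = expMonomial s m := by
  obtain ⟨L, hL⟩ : ∃ L, Tendsto (expMonomial s) atTop (nhds L) := by
    rcases hs.lt_or_eq with hs | rfl
    · refine ⟨0, (isLittleO_one_iff ℂ).1 ?_⟩
      simpa only [expMonomial_zero] using expMonomial_isLittleO hs
    · rw [expMonomial_zero]
      exact ⟨1, tendsto_const_nhds⟩
  exact ⟨OnePoint.continuousMapMkNat (expMonomial s) L hL, ContinuousMap.continuous _,
    fun m => rfl⟩

lemma Vfun_eq_sum_prod_expMonomial {q : ℝ} (hq : 0 < q) {n N : ℕ} (α : Fin N → ℂ)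
    (f : Fin N → MvPolynomial (Fin n) ℚ) (φ : Fin N → ((Fin n → ℚ) →ₗ[ℚ] ℚ)) (x : Fin n → ℕ) :
    Vfun q α f φ x = ∑ i ∈ Finset.univ.sigma fun i => (f i).support,
      (α i.1 * (((f i.1).coeff i.2 : ℚ) : ℂ)) * ∏ j,
        expMonomial (toLex (Real.log q * (φ i.1 (Pi.single j 1) : ℝ), i.2 j)) (x j) := by
  have hexp (i : Fin N) : ((q ^ (((φ i) (fun j => (x j : ℚ)) : ℚ) : ℝ) : ℝ) : ℂ) =
      ∏ j, (Real.exp (Real.log q * (φ i (Pi.single j 1) : ℝ)) : ℂ) ^ x j := by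
    rw [LinearMap.pi_apply_eq_sum_univ, Real.rpow_def_of_pos hq]
    simp only [smul_eq_mul, Rat.cast_sum, Rat.cast_mul, Rat.cast_natCast, Finset.mul_sum,
      Real.exp_sum, Complex.ofReal_prod]
    refine Finset.prod_congr rfl fun j _ => ?_
    rw [← Complex.ofReal_pow, ← Real.exp_nat_mul]
    have : (fun l => if j = l then (1 : ℚ) else 0) = Pi.single j 1 := by
      funext l
      simp [Pi.single_apply, eq_comm]
    rw [this]
    congr 2
    ring
  rw [Vfun, Finset.sum_sigma]
  refine Finset.sum_congr rfl fun i _ => ?_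
  rw [hexp, MvPolynomial.eval_eq', Rat.cast_sum, Finset.mul_sum, Finset.sum_mul]
  refine Finset.sum_congr rfl fun d _ => ?_
  simp only [expMonomial, ofLex_toLex, Finset.prod_mul_distrib]
  push_cast
  ring

/-- If a V-function `R` on `ℤ_{≥0}^n` has no ray `p + ℕ·v` along which `|R| → ∞`, then `R`
extends to a continuous function on `(ℤ_{≥0} ∪ {∞})^n`, the `n`-th power of the one-point
compactification of the discrete space `ℤ_{≥0}`. -/
theorem vfunction_extends_to_onePoint (q : ℝ) (hq : 1 < q) (n N : ℕ)
    (α : Fin N → ℂ) (f : Fin N → MvPolynomial (Fin n) ℚ)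
    (φ : Fin N → ((Fin n → ℚ) →ₗ[ℚ] ℚ))
    (hna : ¬ ∃ P v : Fin n → ℕ, Filter.Tendsto
        (fun m : ℕ => ‖Vfun q α f φ (fun j => P j + m * v j)‖)
        Filter.atTop Filter.atTop) :
    ∃ Rbar : (Fin n → OnePoint ℕ) → ℂ, Continuous Rbar ∧
      ∀ x : Fin n → ℕ, Rbar (fun j => (x j : OnePoint ℕ)) = Vfun q α f φ x := by
  choose! g hg hgeq using fun (s : ℝ ×ₗ ℕ) (hs : s ≤ 0) =>
    exists_continuous_extension_expMonomial hs
  have hsum := sum_eq_sum_bounded _ _ _ _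
    (Vfun_eq_sum_prod_expMonomial (zero_lt_one.trans hq) α f φ)
    fun P v h => hna ⟨P, v, h⟩
  refine ⟨fun y => ∑ i ∈ Finset.univ.sigma (fun i => (f i).support) with
      ∀ j, toLex (Real.log q * (φ i.1 (Pi.single j 1) : ℝ), i.2 j) ≤ 0,
    (α i.1 * (((f i.1).coeff i.2 : ℚ) : ℂ)) * ∏ j,
      g (toLex (Real.log q * (φ i.1 (Pi.single j 1) : ℝ), i.2 j)) (y j), ?_, fun x => ?_⟩
  · refine continuous_finsetSum _ fun i hi => continuous_const.mul ?_
    exact continuous_finsetProd _ fun j _ =>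
      (hg _ ((Finset.mem_filter.1 hi).2 j)).comp (continuous_apply j)
  · rw [hsum x]
    refine Finset.sum_congr rfl fun i hi => ?_
    congr 1
    exact Finset.prod_congr rfl fun j _ => hgeq _ ((Finset.mem_filter.1 hi).2 j) _
end
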